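/- arXiv:2511.11321 — 4 statements merged into one kernel-verified Lean document; each statement's English description precedes it below -/
import Mathlib

section
/- Let φ : [0,∞) → [0,∞) be an index function, i.e. continuous, monotone nondecreasing with φ(0) = 0, and suppose in addition that the function t ↦ φ(t)² is concave on [0,∞). Then φ_app(α) := sup_{τ ∈ [0,∞)} (φ(τ) − τ/α) tends to 0 as α → 0⁺; in particular φ_app(α) is finite for all sufficiently small α > 0. -/
open scoped ENNReal
open Filter

/-- If `φ` is nonnegative and `φ ^ 2` is concave on `[0, ∞)`, then `φ` grows at most linearly
away from the origin. -/
theorem le_div_mul_of_concaveOn_sq {φ : ℝ → ℝ} (hnn : ∀ t : ℝ, 0 ≤ t → 0 ≤ φ t)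
    (hconc : ConcaveOn ℝ (Set.Ici 0) fun t => (φ t) ^ 2) {δ τ : ℝ} (hδ : 0 < δ) (hτ : δ ≤ τ) :
    φ τ ≤ τ / δ * φ δ := by
  have hτ0 : 0 < τ := hδ.trans_le hτ
  have hδτ : δ / τ ≤ 1 := (div_le_one hτ0).2 hτ
  have hr : 1 ≤ τ / δ := (one_le_div hδ).2 hτ
  have hφδ := hnn δ hδ.le
  have hc := hconc.2 (Set.mem_Ici.2 hτ0.le) Set.self_mem_Ici (show 0 ≤ δ / τ by positivity)
    (sub_nonneg.2 hδτ) (by ring)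
  simp only [smul_eq_mul, mul_zero, add_zero, div_mul_cancel₀ _ hτ0.ne'] at hc
  have hsq : δ / τ * φ τ ^ 2 ≤ φ δ ^ 2 := by
    nlinarith [mul_nonneg (sub_nonneg.2 hδτ) (sq_nonneg (φ 0))]
  have hsq' : φ τ ^ 2 ≤ τ / δ * φ δ ^ 2 := by
    calc φ τ ^ 2 = τ / δ * (δ / τ * φ τ ^ 2) := by field_simp
      _ ≤ τ / δ * φ δ ^ 2 := by gcongr
  refine le_of_sq_le_sq ?_ (by positivity)
  calc φ τ ^ 2 ≤ τ / δ * φ δ ^ 2 := hsq'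
    _ ≤ (τ / δ) ^ 2 * φ δ ^ 2 := by gcongr; nlinarith
    _ = (τ / δ * φ δ) ^ 2 := by ring

theorem exists_forall_iSup_ofReal_sub_div_le {φ : ℝ → ℝ} (hcont : ContinuousOn φ (Set.Ici 0))
    (hnn : ∀ t : ℝ, 0 ≤ t → 0 ≤ φ t)
    (hmono : ∀ s t : ℝ, 0 ≤ s → s ≤ t → φ s ≤ φ t) (h0 : φ 0 = 0)
    (hconc : ConcaveOn ℝ (Set.Ici 0) fun t => (φ t) ^ 2) {ε : ℝ} (hε : 0 < ε) :
    ∃ α₀ : ℝ, 0 < α₀ ∧ ∀ α : ℝ, 0 < α → α < α₀ →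
      (⨆ τ : NNReal, ENNReal.ofReal (φ τ - τ / α)) ≤ ENNReal.ofReal ε := by
  obtain ⟨r, hr, hφr⟩ := Metric.continuousOn_iff.1 hcont 0 Set.self_mem_Ici ε hε
  have hδ : 0 < r / 2 := half_pos hr
  have hφδ : φ (r / 2) < ε := by
    have h := hφr (r / 2) hδ.le (by rw [Real.dist_eq, sub_zero, abs_of_pos hδ]; linarith)
    rw [h0, Real.dist_eq, sub_zero] at h
    exact (le_abs_self _).trans_lt h
  generalize r / 2 = δ at hδ hφδ
  refine ⟨δ / ε, by positivity, fun α hα hαδ => iSup_le fun τ => ENNReal.ofReal_le_ofReal ?_⟩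
  have hτ0 : (0 : ℝ) ≤ τ := τ.2
  rcases le_total (τ : ℝ) δ with hτ | hτ
  · have hdiv : 0 ≤ τ / α := by positivity
    linarith [hmono τ δ hτ0 hτ]
  · have hgrowth := le_div_mul_of_concaveOn_sq hnn hconc hδ hτ
    have hslope : τ / δ * φ δ ≤ τ / α := by
      rw [div_mul_eq_mul_div, div_le_div_iff₀ hδ hα, mul_assoc]
      gcongr
      calc φ δ * α ≤ ε * α := by gcongr
        _ ≤ δ := by rw [lt_div_iff₀ hε] at hαδ; linarith
    linarith

/-- If `φ : [0,∞) → [0,∞)` is an index function (continuous, nondecreasing, `φ 0 = 0`)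
such that `t ↦ φ(t)²` is concave on `[0,∞)`, then the approximation-error function
`φ_app α := ⨆ τ ≥ 0, (φ τ - τ/α)` (in `ℝ≥0∞`) tends to `0` as `α → 0⁺`; in particular
it is finite for all sufficiently small `α > 0`. -/
theorem stmt1 (φ : ℝ → ℝ) (hcont : ContinuousOn φ (Set.Ici 0))
    (hnn : ∀ t : ℝ, 0 ≤ t → 0 ≤ φ t)
    (hmono : ∀ s t : ℝ, 0 ≤ s → s ≤ t → φ s ≤ φ t) (h0 : φ 0 = 0)
    (hconc : ConcaveOn ℝ (Set.Ici 0) fun t => (φ t) ^ 2) :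
    Tendsto (fun α : ℝ => ⨆ τ : NNReal, ENNReal.ofReal (φ τ - τ / α))
      (nhdsWithin 0 (Set.Ioi 0)) (nhds 0) ∧
    ∃ α₀ : ℝ, 0 < α₀ ∧ ∀ α : ℝ, 0 < α → α < α₀ →
      (⨆ τ : NNReal, ENNReal.ofReal (φ τ - τ / α)) < ⊤ := by
  refine ⟨ENNReal.tendsto_nhds_zero.2 fun ε hε => ?_, ?_⟩
  · obtain ⟨e, he, heε⟩ := ENNReal.lt_iff_exists_nnreal_btwn.1 hε
    obtain ⟨α₀, hα₀, h⟩ := exists_forall_iSup_ofReal_sub_div_le hcont hnn hmono h0 hconc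
      (ε := e) (by exact_mod_cast he)
    filter_upwards [Ioo_mem_nhdsGT hα₀] with α hα
    refine (h α hα.1 hα.2).trans ?_
    rw [ENNReal.ofReal_coe_nnreal]
    exact heε.le
  · obtain ⟨α₀, hα₀, h⟩ :=
      exists_forall_iSup_ofReal_sub_div_le hcont hnn hmono h0 hconc one_pos
    exact ⟨α₀, hα₀, fun α hα hαα₀ => (h α hα hαα₀).trans_lt ENNReal.ofReal_lt_top⟩
end

section
/- Let (Ω, μ) be a measure space and (M, ν) a finite measure space, let T : L²(Ω, μ; ℝ) → L²(M, ν; ℝ) be a bounded linear operator, let g ∈ L²(M, ν; ℝ) and α > 0. Then the Tikhonov functional J(u) := ‖Tu − g‖_{L¹(ν)} + α·‖u‖²_{L²(μ)} (which is finite for every u ∈ L²(μ) since ν is finite) has a unique global minimizer: there exists a unique û ∈ L²(Ω, μ; ℝ) with J(û) ≤ J(u) for all u ∈ L²(Ω, μ; ℝ). -/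
open MeasureTheory

open Filter Topology in
/-- A nonnegative, continuous, convex function on a Hilbert space, perturbed by a positive multiple
of the squared norm, has a unique global minimizer. -/
theorem ConvexOn.existsUnique_forall_add_norm_sq_le {E : Type*} [NormedAddCommGroup E]
    [InnerProductSpace ℝ E] [CompleteSpace E] {F : E → ℝ} (hconv : ConvexOn ℝ Set.univ F)
    (hcont : Continuous F) (hnonneg : ∀ u, 0 ≤ F u) {α : ℝ} (hα : 0 < α) :
    ∃! u, ∀ v, F u + α * ‖u‖ ^ 2 ≤ F v + α * ‖v‖ ^ 2 := by
  set J : E → ℝ := fun u ↦ F u + α * ‖u‖ ^ 2 with hJ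
  have hmid (u v : E) :
      J ((1 / 2 : ℝ) • u + (1 / 2 : ℝ) • v) + α / 4 * ‖u - v‖ ^ 2 ≤ (J u + J v) / 2 := by
    have h₁ := hconv.2 (Set.mem_univ u) (Set.mem_univ v)
      (by norm_num : (0 : ℝ) ≤ 1 / 2) (by norm_num : (0 : ℝ) ≤ 1 / 2) (by norm_num)
    have h₂ := parallelogram_law_with_norm ℝ u v
    have h₃ : ‖(1 / 2 : ℝ) • u + (1 / 2 : ℝ) • v‖ = 1 / 2 * ‖u + v‖ := by
      rw [← smul_add, norm_smul]
      norm_num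
    simp only [hJ, h₃, smul_eq_mul] at h₁ ⊢
    linear_combination h₁ + α / 4 * h₂
  have hJnonneg (u : E) : 0 ≤ J u := add_nonneg (hnonneg u) (by positivity)
  have hbdd : BddBelow (Set.range J) := ⟨0, by rintro _ ⟨u, rfl⟩; exact hJnonneg u⟩
  have hle (u : E) : ⨅ v, J v ≤ J u := ciInf_le hbdd u
  have hsq {u v : E} {ε : ℝ} (hu : J u ≤ (⨅ v, J v) + ε) (hv : J v ≤ (⨅ v, J v) + ε) :
      ‖u - v‖ ^ 2 ≤ 4 / α * ε := by
    have h₁ : α / 4 * ‖u - v‖ ^ 2 ≤ ε := by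
      linarith [hmid u v, hle ((1 / 2 : ℝ) • u + (1 / 2 : ℝ) • v)]
    calc ‖u - v‖ ^ 2 = 4 / α * (α / 4 * ‖u - v‖ ^ 2) := by field_simp
      _ ≤ 4 / α * ε := by gcongr
  have hseq (n : ℕ) : ∃ u, J u < (⨅ v, J v) + 1 / ((n : ℝ) + 1) :=
    exists_lt_of_ciInf_lt (lt_add_of_pos_right _ (by positivity))
  choose w hw using hseq
  have hlim : Tendsto (fun n : ℕ ↦ 1 / ((n : ℝ) + 1)) atTop (𝓝 0) :=
    tendsto_one_div_add_atTop_nhds_zero_nat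
  have hcauchy : CauchySeq w := by
    refine cauchySeq_of_le_tendsto_0 (fun n : ℕ ↦ √(4 / α * (1 / ((n : ℝ) + 1)))) ?_ ?_
    · intro n k N hn hk
      have hmono {n : ℕ} (hn : N ≤ n) : J (w n) ≤ (⨅ v, J v) + 1 / ((N : ℝ) + 1) :=
        (hw n).le.trans (add_le_add_right (Nat.one_div_le_one_div hn) _)
      rw [dist_eq_norm]
      exact Real.le_sqrt_of_sq_le (hsq (hmono hn) (hmono hk))
    · simpa using (hlim.const_mul (4 / α)).sqrt
  obtain ⟨u, hu⟩ := cauchySeq_tendsto_of_complete hcauchy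
  have hJcont : Continuous J := by fun_prop
  have hJu : J u ≤ ⨅ v, J v := by
    refine le_of_tendsto_of_tendsto' ((hJcont.tendsto u).comp hu) ?_ fun n ↦ (hw n).le
    simpa using hlim.const_add (⨅ v, J v)
  refine ⟨u, fun v ↦ hJu.trans (hle v), fun v hv ↦ ?_⟩
  have h := hsq (ε := 0) (u := v) (v := u) (by simpa using (hv u).trans hJu) (by simpa using hJu)
  rw [mul_zero] at h
  exact sub_eq_zero.1 (norm_eq_zero.1 (pow_eq_zero_iff two_ne_zero |>.1 (h.antisymm (sq_nonneg _))))

theorem MeasureTheory.Lp.integrable_of_isFiniteMeasure {M : Type*} [MeasurableSpace M]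
    {ν : Measure M} [IsFiniteMeasure ν] (f : Lp ℝ 2 ν) : Integrable f ν :=
  (Lp.memLp f).integrable one_le_two

/-- On a finite measure space the `L¹` norm is continuous on `L²`. -/
theorem MeasureTheory.Lp.continuous_integral_abs {M : Type*} [MeasurableSpace M]
    (ν : Measure M) [IsFiniteMeasure ν] : Continuous fun f : Lp ℝ 2 ν ↦ ∫ x, |f x| ∂ν := by
  have h (f : Lp ℝ 2 ν) : ∫ x, |f x| ∂ν =
      inner ℝ (indicatorConstLp 2 MeasurableSet.univ (measure_ne_top ν _) (1 : ℝ)) |f| := by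
    rw [L2.inner_indicatorConstLp_one, setIntegral_univ]
    exact integral_congr_ae (Lp.coeFn_abs f).symm
  simp_rw [h]
  exact continuous_const.inner (continuous_id.sup continuous_neg)

/-- On a finite measure space the `L¹` norm is convex on `L²`. -/
theorem MeasureTheory.Lp.convexOn_integral_abs {M : Type*} [MeasurableSpace M]
    (ν : Measure M) [IsFiniteMeasure ν] :
    ConvexOn ℝ Set.univ fun f : Lp ℝ 2 ν ↦ ∫ x, |f x| ∂ν := by
  refine ⟨convex_univ, fun f _ h _ a b ha hb _ ↦ ?_⟩
  have hf := (Lp.integrable_of_isFiniteMeasure f).abs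
  have hh := (Lp.integrable_of_isFiniteMeasure h).abs
  simp only [smul_eq_mul]
  rw [← integral_const_mul, ← integral_const_mul,
    ← integral_add (hf.const_mul a) (hh.const_mul b)]
  refine integral_mono_ae (Lp.integrable_of_isFiniteMeasure _).abs
    ((hf.const_mul a).add (hh.const_mul b)) ?_
  filter_upwards [Lp.coeFn_add (a • f) (b • h), Lp.coeFn_smul a f, Lp.coeFn_smul b h]
    with x h₁ h₂ h₃
  rw [h₁, Pi.add_apply, h₂, h₃]
  simpa [abs_mul, abs_of_nonneg ha, abs_of_nonneg hb] using abs_add_le (a * f x) (b * h x)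

/-- Existence and uniqueness of the minimizer of the Tikhonov functional
`J(u) = ‖Tu − g‖_{L¹(ν)} + α‖u‖²_{L²(μ)}` for a bounded linear operator
`T : L²(μ) → L²(ν)` with `ν` a finite measure and `α > 0`. -/
theorem stmt6 {Ω M : Type*} [MeasurableSpace Ω] [MeasurableSpace M]
    (μ : Measure Ω) (ν : Measure M) [IsFiniteMeasure ν]
    (T : Lp ℝ 2 μ →L[ℝ] Lp ℝ 2 ν) (g : Lp ℝ 2 ν) (α : ℝ) (hα : 0 < α) :
    ∃! u : Lp ℝ 2 μ, ∀ v : Lp ℝ 2 μ,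
      (∫ x, |(T u - g : Lp ℝ 2 ν) x| ∂ν) + α * ‖u‖ ^ 2 ≤
        (∫ x, |(T v - g : Lp ℝ 2 ν) x| ∂ν) + α * ‖v‖ ^ 2 := by
  refine ConvexOn.existsUnique_forall_add_norm_sq_le
    (F := fun u ↦ ∫ x, |(T u - g : Lp ℝ 2 ν) x| ∂ν) ?_ ?_ ?_ hα
  · have h := ((Lp.convexOn_integral_abs ν).translate_left (-g)).comp_linearMap T.toLinearMap
    simpa [Function.comp_def, sub_eq_add_neg] using h
  · exact (Lp.continuous_integral_abs ν).comp (T.continuous.sub continuous_const)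
  · exact fun u ↦ integral_nonneg fun x ↦ abs_nonneg _
end

section
/- Let Φ be the standard normal cumulative distribution function, Φ(x) = (2π)^{−1/2}·∫_{−∞}^x exp(−t²/2) dt, and let θ > 0. Then there exist C > 0 and σ₀ ∈ (0, 1) such that for every σ ∈ (0, σ₀) there exist λ > 0 and α > 0 with (σ·√(1 − 2Φ(−λ/σ)))/α + Φ(−λ/σ)/α² + α^θ ≤ C·σ^{θ/(θ+1)}. -/
/-- The lower Gaussian tail integral is dominated by the exponential function on `(-∞, -2]`. -/
theorem integral_Iic_exp_neg_sq_div_two_le {x : ℝ} (hx : x ≤ -2) :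
    ∫ t in Set.Iic x, Real.exp (-t ^ 2 / 2) ≤ Real.exp x := by
  have hint : MeasureTheory.Integrable (fun t : ℝ => Real.exp (-t ^ 2 / 2)) := by
    refine (integrable_exp_neg_mul_sq (b := 1 / 2) (by norm_num)).congr (.of_forall fun t => ?_)
    ring_nf
  rw [← integral_exp_Iic x]
  refine MeasureTheory.setIntegral_mono_on hint.integrableOn (integrableOn_exp_Iic x)
    measurableSet_Iic fun t ht => Real.exp_le_exp.mpr ?_
  have ht2 : t ≤ -2 := le_trans ht hx
  nlinarith

theorem two_pi_rpow_neg_half_le_one : (2 * Real.pi) ^ (-(1 / 2 : ℝ)) ≤ 1 :=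
  Real.rpow_le_one_of_one_le_of_nonpos (by linarith [Real.pi_gt_three]) (by norm_num)


/-- Gaussian convergence rate: for the standard normal cdf `Φ` and any `θ > 0`,
there are `C > 0` and `σ₀ ∈ (0,1)` such that for every `σ ∈ (0, σ₀)` a threshold
`λ > 0` and a regularization parameter `α > 0` can be chosen with
`σ·√(1 − 2Φ(−λ/σ))/α + Φ(−λ/σ)/α² + α^θ ≤ C·σ^{θ/(θ+1)}`. -/
theorem stmt15 (Φ : ℝ → ℝ)
    (hΦ : ∀ x : ℝ, Φ x = (2 * Real.pi) ^ (-(1 / 2 : ℝ)) *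
      ∫ t in Set.Iic x, Real.exp (-t ^ 2 / 2))
    (θ : ℝ) (hθ : 0 < θ) :
    ∃ C : ℝ, 0 < C ∧ ∃ σ₀ : ℝ, 0 < σ₀ ∧ σ₀ < 1 ∧
      ∀ σ : ℝ, 0 < σ → σ < σ₀ →
        ∃ lam : ℝ, 0 < lam ∧ ∃ α : ℝ, 0 < α ∧
          σ * Real.sqrt (1 - 2 * Φ (-(lam / σ))) / α + Φ (-(lam / σ)) / α ^ 2
              + α ^ θ ≤ C * σ ^ (θ / (θ + 1)) := by
  refine ⟨3, by norm_num, 1 / 2, by norm_num, by norm_num, fun σ hσ hσ₀ => ?_⟩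
  have hσ1 : σ < 1 := by linarith
  have hlog : Real.log σ < 0 := Real.log_neg hσ hσ1
  refine ⟨σ * (2 - 2 * Real.log σ), by apply mul_pos hσ; linarith,
    σ ^ (1 / (θ + 1)), by positivity, ?_⟩
  rw [mul_div_cancel_left₀ _ hσ.ne']
  set x := -(2 - 2 * Real.log σ) with hx
  set α := σ ^ (1 / (θ + 1)) with hα
  set r := σ ^ (θ / (θ + 1)) with hr
  have hα0 : 0 < α := by positivity
  have hr0 : 0 < r := by positivity
  have hr1 : r ≤ 1 := Real.rpow_le_one hσ.le hσ1.le (by positivity)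
  have hαr : σ = r * α := by
    rw [hr, hα, ← Real.rpow_add hσ, ← add_div, div_self (by positivity), Real.rpow_one]
  have hαθ : α ^ θ = r := by
    rw [hα, hr, ← Real.rpow_mul hσ.le]
    ring_nf
  have hI0 : 0 ≤ ∫ t in Set.Iic x, Real.exp (-t ^ 2 / 2) :=
    MeasureTheory.integral_nonneg fun t => (Real.exp_pos _).le
  have hΦ0 : 0 ≤ Φ x := by
    rw [hΦ]
    positivity
  have hΦσ : Φ x ≤ σ ^ 2 :=
    calc Φ x ≤ ∫ t in Set.Iic x, Real.exp (-t ^ 2 / 2) := by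
          rw [hΦ]
          exact mul_le_of_le_one_left hI0 two_pi_rpow_neg_half_le_one
      _ ≤ Real.exp x := integral_Iic_exp_neg_sq_div_two_le (by linarith)
      _ ≤ Real.exp (2 * Real.log σ) := Real.exp_le_exp.mpr (by linarith)
      _ = σ ^ 2 := by
          rw [two_mul, Real.exp_add, Real.exp_log hσ, sq]
  have hsqrt : Real.sqrt (1 - 2 * Φ x) ≤ 1 := Real.sqrt_le_one.mpr (by linarith)
  have h1 : σ * Real.sqrt (1 - 2 * Φ x) / α ≤ r := by
    rw [div_le_iff₀ hα0, ← hαr]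
    exact mul_le_of_le_one_right hσ.le hsqrt
  have h2 : Φ x / α ^ 2 ≤ r := by
    rw [div_le_iff₀ (by positivity)]
    calc Φ x ≤ σ ^ 2 := hΦσ
      _ = r ^ 2 * α ^ 2 := by rw [← mul_pow, ← hαr]
      _ ≤ r * α ^ 2 := by
          gcongr
          nlinarith
  linarith
end

section
/- Let E and H be real Hilbert spaces, T : E → H a bounded linear operator with Hilbert-space adjoint T* and operator norm ‖T‖, let α > 0, ρ > 0, β > ρ·‖T‖², c ∈ H and ũ ∈ E. Define G := β·id_E − ρ·T*T. Then (i) ⟨G u, u⟩ ≥ (β − ρ‖T‖²)·‖u‖² > 0 for all u ≠ 0, so that ‖u‖_G² := ⟨G u, u⟩ defines a (squared) norm on E; and (ii) the functional u ↦ α·‖u‖² + (ρ/2)·‖Tu − c‖² + (1/2)·⟨G(u − ũ), u − ũ⟩ has a unique global minimizer over E, namely u* = (1 + 2α/β)^{−1}·( ũ − (ρ/β)·T*(T ũ − c) ). -/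
open scoped RealInnerProductSpace

section LinearizedProximal

variable {E H : Type*}
  [NormedAddCommGroup E] [InnerProductSpace ℝ E] [CompleteSpace E]
  [NormedAddCommGroup H] [InnerProductSpace ℝ H] [CompleteSpace H]

theorem inner_smul_id_sub_smul_adjoint_comp_self (T : E →L[ℝ] H) (ρ β : ℝ) (x : E) :
    ⟪(β • ContinuousLinearMap.id ℝ E - ρ • ((ContinuousLinearMap.adjoint T).comp T)) x, x⟫ =
      β * ‖x‖ ^ 2 - ρ * ‖T x‖ ^ 2 := by
  simp [inner_sub_left, real_inner_smul_left, ContinuousLinearMap.adjoint_inner_left]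

theorem le_inner_smul_id_sub_smul_adjoint_comp_self (T : E →L[ℝ] H) {ρ : ℝ} (hρ : 0 ≤ ρ)
    (β : ℝ) (x : E) :
    (β - ρ * ‖T‖ ^ 2) * ‖x‖ ^ 2 ≤
      ⟪(β • ContinuousLinearMap.id ℝ E - ρ • ((ContinuousLinearMap.adjoint T).comp T)) x, x⟫ := by
  rw [inner_smul_id_sub_smul_adjoint_comp_self]
  have h : ρ * ‖T x‖ ^ 2 ≤ ρ * (‖T‖ * ‖x‖) ^ 2 := by
    gcongr
    exact T.le_opNorm x
  linarith

/-- A critical point `z` of the linearized proximal functional exhibits that functional as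
a constant plus a multiple of the squared distance to `z`. -/
theorem linearizedProximal_eq_add_norm_sub_sq (T : E →L[ℝ] H) (α ρ β : ℝ) (c : H) {y z : E}
    (hz : (2 * α + β) • z = β • y - ρ • ContinuousLinearMap.adjoint T (T y - c)) (v : E) :
    α * ‖v‖ ^ 2 + (ρ / 2) * ‖T v - c‖ ^ 2 + (1 / 2) *
        ⟪(β • ContinuousLinearMap.id ℝ E - ρ • ((ContinuousLinearMap.adjoint T).comp T)) (v - y),
          v - y⟫ =
      α * ‖z‖ ^ 2 + (ρ / 2) * ‖T z - c‖ ^ 2 + (1 / 2) *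
        ⟪(β • ContinuousLinearMap.id ℝ E - ρ • ((ContinuousLinearMap.adjoint T).comp T)) (z - y),
          z - y⟫ + (α + β / 2) * ‖v - z‖ ^ 2 := by
  have key (x : E) : (2 * α + β) * ⟪z, x⟫ = β * ⟪y, x⟫ - ρ * (⟪T y, T x⟫ - ⟪c, T x⟫) := by
    rw [← real_inner_smul_left, hz, inner_sub_left, real_inner_smul_left, real_inner_smul_left,
      ContinuousLinearMap.adjoint_inner_left, inner_sub_left]
  have hv := key v
  have hz' := key z
  rw [inner_smul_id_sub_smul_adjoint_comp_self, inner_smul_id_sub_smul_adjoint_comp_self]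
  simp only [map_sub, norm_sub_sq_real]
  simp only [real_inner_self_eq_norm_sq] at hz'
  rw [real_inner_comm v z, real_inner_comm v y, real_inner_comm (T v) (T y),
    real_inner_comm (T v) c] at hv
  rw [real_inner_comm z y, real_inner_comm (T z) (T y), real_inner_comm (T z) c] at hz'
  linarith

end LinearizedProximal

/-- The AD-LPMM `u`-update: for Hilbert spaces `E, H`, `T : E → H` bounded linear,
`α, ρ > 0`, `β > ρ‖T‖²`, `c ∈ H` and `ũ ∈ E`, the operator `G = β·id − ρ·T*T`
satisfies `⟨Gu, u⟩ ≥ (β − ρ‖T‖²)‖u‖² > 0` for `u ≠ 0`, and the functional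
`u ↦ α‖u‖² + (ρ/2)‖Tu − c‖² + ½⟨G(u − ũ), u − ũ⟩` has the unique global minimizer
`u* = (1 + 2α/β)⁻¹·(ũ − (ρ/β)·T*(Tũ − c))`. -/
theorem stmt19 {E H : Type*}
    [NormedAddCommGroup E] [InnerProductSpace ℝ E] [CompleteSpace E]
    [NormedAddCommGroup H] [InnerProductSpace ℝ H] [CompleteSpace H]
    (T : E →L[ℝ] H) (α ρ β : ℝ) (hα : 0 < α) (hρ : 0 < ρ)
    (hβ : ρ * ‖T‖ ^ 2 < β) (c : H) (utilde : E) :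
    let G : E →L[ℝ] E :=
      β • ContinuousLinearMap.id ℝ E - ρ • ((ContinuousLinearMap.adjoint T).comp T)
    let J : E → ℝ := fun u =>
      α * ‖u‖ ^ 2 + (ρ / 2) * ‖T u - c‖ ^ 2 + (1 / 2) * ⟪G (u - utilde), u - utilde⟫
    let ustar : E :=
      (1 + 2 * α / β)⁻¹ • (utilde - (ρ / β) • (ContinuousLinearMap.adjoint T) (T utilde - c))
    (∀ u : E, (β - ρ * ‖T‖ ^ 2) * ‖u‖ ^ 2 ≤ ⟪G u, u⟫) ∧
    (∀ u : E, u ≠ 0 → 0 < ⟪G u, u⟫) ∧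
    (∀ v : E, J ustar ≤ J v) ∧
    (∀ u : E, (∀ v : E, J u ≤ J v) → u = ustar) := by
  intro G J ustar
  have hβ0 : 0 < β := lt_of_le_of_lt (by positivity) hβ
  have hG (u : E) : (β - ρ * ‖T‖ ^ 2) * ‖u‖ ^ 2 ≤ ⟪G u, u⟫ :=
    le_inner_smul_id_sub_smul_adjoint_comp_self T hρ.le β u
  have hcrit : (2 * α + β) • ustar =
      β • utilde - ρ • ContinuousLinearMap.adjoint T (T utilde - c) := by
    have h₁ : (2 * α + β) * (1 + 2 * α / β)⁻¹ = β := by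
      field_simp
      ring
    have h₂ : β * (ρ / β) = ρ := by field_simp
    simp only [ustar]
    rw [smul_smul, h₁, smul_sub, smul_smul, h₂]
  have hJ (v : E) : J v = J ustar + (α + β / 2) * ‖v - ustar‖ ^ 2 :=
    linearizedProximal_eq_add_norm_sub_sq T α ρ β c hcrit v
  refine ⟨hG, fun u hu => ?_, fun v => ?_, fun u hu => ?_⟩
  · have h : 0 < ‖u‖ := norm_pos_iff.mpr hu
    exact lt_of_lt_of_le (mul_pos (sub_pos.mpr hβ) (by positivity)) (hG u)
  · rw [hJ v]
    exact le_add_of_nonneg_right (by positivity)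
  · by_contra hne
    have h : 0 < ‖u - ustar‖ := norm_pos_iff.mpr (sub_ne_zero.mpr hne)
    have hpos : 0 < (α + β / 2) * ‖u - ustar‖ ^ 2 := by positivity
    linarith [hu ustar, hJ u]
end
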